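/- Let t < T be real numbers, Δ = T − t, and let {φ_j} be the shifted Legendre system on [t, T]. For j₁, j₂ ∈ ℕ define C_{j₂j₁} = ∫_t^T φ_{j₂}(s) (∫_t^s φ_{j₁}(τ) dτ) ds. Then C_{00} = Δ/2; C_{j₂j₁} = Δ/(2√(4j₂² − 1)) whenever j₁ = j₂ − 1 (j₂ ≥ 1); C_{j₂j₁} = −Δ/(2√(4j₁² − 1)) whenever j₂ = j₁ − 1 (j₁ ≥ 1); and C_{j₂j₁} = 0 in all other cases. -/

import Mathlib

/-- The Legendre polynomial via the Rodrigues formula. -/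
noncomputable def legendreP (n : ℕ) (x : ℝ) : ℝ :=
  (1 / (2 ^ n * (Nat.factorial n : ℝ))) *
    iteratedDeriv n (fun y : ℝ => (y ^ 2 - 1) ^ n) x

/-- The shifted Legendre system on `[t, T]`. -/
noncomputable def shiftedLegendre (t T : ℝ) (j : ℕ) (x : ℝ) : ℝ :=
  Real.sqrt ((2 * (j : ℝ) + 1) / (T - t)) *
    legendreP j ((x - t - (T - t) / 2) * (2 / (T - t)))

open Polynomial in
/-- The Legendre polynomial as an element of `ℝ[X]`. -/
noncomputable def legendrePoly (n : ℕ) : ℝ[X] :=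
  C (1 / (2 ^ n * (Nat.factorial n : ℝ))) * derivative^[n] ((X ^ 2 - 1) ^ n)

open Polynomial in
theorem legendreP_eq_eval (n : ℕ) (x : ℝ) : legendreP n x = (legendrePoly n).eval x := by
  have hfun : (fun y : ℝ => (y ^ 2 - 1) ^ n) = fun y => ((X ^ 2 - 1 : ℝ[X]) ^ n).eval y := by
    ext y; simp
  have hderiv : ∀ p : ℝ[X], deriv (fun y => p.eval y) = fun y => p.derivative.eval y := fun p => by
    ext y; exact p.deriv
  have hiter : ∀ (k : ℕ) (p : ℝ[X]), deriv^[k] (fun y => p.eval y) =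
      fun y => (derivative^[k] p).eval y := fun k => by
    induction k with
    | zero => exact fun p => rfl
    | succ k ih => exact fun p => by rw [Function.iterate_succ_apply, hderiv, ih,
        Function.iterate_succ_apply]
  rw [legendreP, legendrePoly, hfun, iteratedDeriv_eq_iterate, hiter, eval_mul, eval_C]

open Polynomial in
theorem eval_one_iterate_derivative {k m : ℕ} (hk : k < m) :
    (derivative^[k] ((X ^ 2 - 1 : ℝ[X]) ^ m)).eval 1 = 0 := by
  have hdvd : (X - C 1 : ℝ[X]) ^ m ∣ (X ^ 2 - 1) ^ m :=
    pow_dvd_pow_of_dvd ⟨X + 1, by simp; ring⟩ m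
  have := pow_sub_dvd_iterate_derivative_of_pow_dvd k hdvd
  exact dvd_iff_isRoot.mp ((dvd_pow_self _ (by omega)).trans this)

open Polynomial in
theorem eval_neg_one_iterate_derivative {k m : ℕ} (hk : k < m) :
    (derivative^[k] ((X ^ 2 - 1 : ℝ[X]) ^ m)).eval (-1) = 0 := by
  have hdvd : (X - C (-1) : ℝ[X]) ^ m ∣ (X ^ 2 - 1) ^ m :=
    pow_dvd_pow_of_dvd ⟨X - 1, by simp; ring⟩ m
  have := pow_sub_dvd_iterate_derivative_of_pow_dvd k hdvd
  exact dvd_iff_isRoot.mp ((dvd_pow_self _ (by omega)).trans this)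

open Polynomial in
theorem integral_iterate_derivative_succ_mul {k m : ℕ} (hk : k < m) {F : ℝ → ℝ} {p : ℝ[X]}
    (hF : ∀ x, HasDerivAt F (p.eval x) x) :
    ∫ x in (-1 : ℝ)..1, (derivative^[k + 1] ((X ^ 2 - 1 : ℝ[X]) ^ m)).eval x * F x =
      -∫ x in (-1 : ℝ)..1, (derivative^[k] ((X ^ 2 - 1 : ℝ[X]) ^ m)).eval x * p.eval x := by
  have := intervalIntegral.integral_deriv_mul_eq_sub (a := (-1 : ℝ)) (b := 1)
    (u := fun x => (derivative^[k] ((X ^ 2 - 1 : ℝ[X]) ^ m)).eval x) (v := F)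
    (u' := fun x => (derivative^[k + 1] ((X ^ 2 - 1 : ℝ[X]) ^ m)).eval x)
    (v' := fun x => p.eval x)
    (fun x _ => by
      rw [Function.iterate_succ_apply']
      exact Polynomial.hasDerivAt _ x)
    (fun x _ => hF x)
    ((Polynomial.continuous _).intervalIntegrable _ _)
    ((Polynomial.continuous _).intervalIntegrable _ _)
  have hFc : Continuous F := continuous_iff_continuousAt.mpr fun x => (hF x).continuousAt
  rw [intervalIntegral.integral_add (Continuous.intervalIntegrable (by fun_prop) _ _)
    (Continuous.intervalIntegrable (by fun_prop) _ _)] at this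
  rw [eval_one_iterate_derivative hk, eval_neg_one_iterate_derivative hk] at this
  linarith

open Polynomial in
theorem integral_iterate_derivative_mul {k m : ℕ} (hk : k ≤ m) (p : ℝ[X]) :
    ∫ x in (-1 : ℝ)..1, (derivative^[k] ((X ^ 2 - 1 : ℝ[X]) ^ m)).eval x * p.eval x =
      (-1) ^ k * ∫ x in (-1 : ℝ)..1, (x ^ 2 - 1) ^ m * (derivative^[k] p).eval x := by
  induction k generalizing p with
  | zero => simp
  | succ k ih =>
    rw [integral_iterate_derivative_succ_mul hk fun x => p.hasDerivAt x, ih (by omega),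
      Function.iterate_succ_apply]
    ring

theorem integral_sq_sub_one_pow (m : ℕ) :
    ∫ x in (-1 : ℝ)..1, (x ^ 2 - 1) ^ m =
      (-1) ^ m * (2 ^ (2 * m + 1) * (m.factorial : ℝ) ^ 2 / ((2 * m + 1).factorial : ℝ)) := by
  induction m with
  | zero => norm_num
  | succ m ih =>
    have h := intervalIntegral.integral_eq_sub_of_hasDerivAt (a := (-1 : ℝ)) (b := 1)
      (f := fun x : ℝ => x * (x ^ 2 - 1) ^ (m + 1))
      (f' := fun x : ℝ => (2 * m + 3) * (x ^ 2 - 1) ^ (m + 1) + 2 * (m + 1) * (x ^ 2 - 1) ^ m)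
      (fun x _ => by
        refine ((hasDerivAt_id x).mul
          ((((hasDerivAt_id x).pow 2).sub_const 1).pow (m + 1))).congr_deriv ?_
        simp only [Pi.pow_apply, id_eq]
        push_cast
        ring)
      (Continuous.intervalIntegrable (by fun_prop) _ _)
    rw [intervalIntegral.integral_add (Continuous.intervalIntegrable (by fun_prop) _ _)
      (Continuous.intervalIntegrable (by fun_prop) _ _), intervalIntegral.integral_const_mul,
      intervalIntegral.integral_const_mul, ih] at h
    have hfac : ((2 * (m + 1) + 1).factorial : ℝ) =
        (2 * m + 3) * ((2 * m + 2) * (2 * m + 1).factorial) := by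
      rw [show 2 * (m + 1) + 1 = (2 * m + 1 + 1) + 1 by ring, Nat.factorial_succ,
        Nat.factorial_succ]
      push_cast
      ring
    have h0 : ((2 * m + 1).factorial : ℝ) ≠ 0 := by positivity
    have h3 : (2 * m + 3 : ℝ) ≠ 0 := by positivity
    rw [hfac, Nat.factorial_succ]
    apply mul_left_cancel₀ h3
    norm_num at h
    rw [eq_neg_of_add_eq_zero_left h]
    push_cast
    field_simp
    ring

/-- The coefficients on `[-1, 1]`, before normalization and rescaling. -/
noncomputable def legendreCoeff (m n : ℕ) : ℝ :=
  ∫ x in (-1 : ℝ)..1, (legendrePoly m).eval x * ∫ y in (-1 : ℝ)..x, (legendrePoly n).eval y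

theorem hasDerivAt_integral_legendrePoly (n : ℕ) (x : ℝ) :
    HasDerivAt (fun x => ∫ y in (-1 : ℝ)..x, (legendrePoly n).eval y)
      ((legendrePoly n).eval x) x :=
  (legendrePoly n).continuous.integral_hasStrictDerivAt (-1) x |>.hasDerivAt

open Polynomial in
theorem iterate_derivative_legendrePoly (k n : ℕ) :
    derivative^[k] (legendrePoly n) =
      C (1 / (2 ^ n * (Nat.factorial n : ℝ))) * derivative^[k + n] ((X ^ 2 - 1) ^ n) := by
  rw [legendrePoly, iterate_derivative_C_mul, Function.iterate_add_apply]

open Polynomial in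
theorem legendreCoeff_succ (m n : ℕ) :
    legendreCoeff (m + 1) n = 1 / (2 ^ (m + 1) * ((m + 1).factorial : ℝ)) *
      ((-1) ^ (m + 1) * ∫ x in (-1 : ℝ)..1,
        (x ^ 2 - 1) ^ (m + 1) * (derivative^[m] (legendrePoly n)).eval x) := by
  have h : ∀ x, (legendrePoly (m + 1)).eval x = 1 / (2 ^ (m + 1) * ((m + 1).factorial : ℝ)) *
      (derivative^[m + 1] ((X ^ 2 - 1 : ℝ[X]) ^ (m + 1))).eval x := fun x => by
    rw [legendrePoly, eval_mul, eval_C]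
  simp_rw [legendreCoeff, h, mul_assoc]
  rw [intervalIntegral.integral_const_mul, integral_iterate_derivative_succ_mul (Nat.lt_succ_self m)
    (hasDerivAt_integral_legendrePoly n), integral_iterate_derivative_mul (Nat.le_succ m)]
  ring

open Polynomial in
theorem natDegree_sq_sub_one_pow (n : ℕ) : ((X ^ 2 - 1 : ℝ[X]) ^ n).natDegree = 2 * n := by
  rw [natDegree_pow, show (X ^ 2 - 1 : ℝ[X]) = X ^ 2 - C 1 by simp, natDegree_X_pow_sub_C, mul_comm]

theorem legendreCoeff_eq_zero_of_lt {m n : ℕ} (h : n < m) : legendreCoeff (m + 1) n = 0 := by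
  rw [legendreCoeff_succ, iterate_derivative_legendrePoly,
    Polynomial.iterate_derivative_eq_zero (by rw [natDegree_sq_sub_one_pow]; omega)]
  simp

open Polynomial in
theorem iterate_derivative_sq_sub_one_pow (n : ℕ) :
    derivative^[n + n] ((X ^ 2 - 1 : ℝ[X]) ^ n) = C ((2 * n).factorial : ℝ) := by
  have hm : ((X ^ 2 - 1 : ℝ[X]) ^ n).Monic := by
    rw [show (X ^ 2 - 1 : ℝ[X]) = X ^ 2 - C 1 by simp]
    exact (monic_X_pow_sub_C 1 two_ne_zero).pow n
  have hd := natDegree_sq_sub_one_pow n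
  rw [← two_mul]
  have hle := natDegree_iterate_derivative ((X ^ 2 - 1 : ℝ[X]) ^ n) (2 * n)
  rw [hd, Nat.sub_self] at hle
  rw [eq_C_of_natDegree_le_zero hle, coeff_iterate_derivative, zero_add]
  have hc : ((X ^ 2 - 1 : ℝ[X]) ^ n).coeff (2 * n) = 1 := by
    rw [← hd]
    exact hm.coeff_natDegree
  rw [hc, Nat.descFactorial_self, nsmul_one]

theorem legendreCoeff_succ_self (n : ℕ) :
    legendreCoeff (n + 1) n = 2 / ((2 * n + 1) * (2 * n + 3)) := by
  rw [legendreCoeff_succ, iterate_derivative_legendrePoly, iterate_derivative_sq_sub_one_pow]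
  simp only [Polynomial.eval_mul, Polynomial.eval_C]
  rw [intervalIntegral.integral_mul_const, integral_sq_sub_one_pow,
    show 2 * (n + 1) + 1 = 2 * n + 1 + 1 + 1 by ring]
  simp only [Nat.factorial_succ]
  have hs : ((-1 : ℝ) ^ (n + 1)) * (-1) ^ (n + 1) = 1 := by
    rw [← mul_pow]; simp
  simp only [← mul_assoc]
  rw [mul_assoc _ ((-1 : ℝ) ^ (n + 1)) ((-1) ^ (n + 1)), hs]
  have h0 : ((2 * n).factorial : ℝ) ≠ 0 := by positivity
  have h1 : (n.factorial : ℝ) ≠ 0 := by positivity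
  push_cast
  field_simp
  ring

theorem integral_legendrePoly_succ (n : ℕ) :
    ∫ x in (-1 : ℝ)..1, (legendrePoly (n + 1)).eval x = 0 := by
  have h := integral_iterate_derivative_succ_mul (Nat.lt_succ_self n) (F := fun _ => 1) (p := 0)
    (fun x => by simpa using hasDerivAt_const x (1 : ℝ))
  simp only [mul_one, Polynomial.eval_zero, mul_zero, intervalIntegral.integral_zero,
    neg_zero] at h
  simp only [legendrePoly, Polynomial.eval_mul, Polynomial.eval_C]
  rw [intervalIntegral.integral_const_mul, h, mul_zero]

theorem legendreCoeff_add_swap (m n : ℕ) :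
    legendreCoeff m n + legendreCoeff n m =
      (∫ x in (-1 : ℝ)..1, (legendrePoly m).eval x) *
        ∫ x in (-1 : ℝ)..1, (legendrePoly n).eval x := by
  have hc : ∀ k, Continuous fun x => ∫ y in (-1 : ℝ)..x, (legendrePoly k).eval y := fun k =>
    continuous_iff_continuousAt.mpr fun x => (hasDerivAt_integral_legendrePoly k x).continuousAt
  have h := intervalIntegral.integral_deriv_mul_eq_sub (a := (-1 : ℝ)) (b := 1)
    (fun x _ => hasDerivAt_integral_legendrePoly m x)
    (fun x _ => hasDerivAt_integral_legendrePoly n x)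
    ((Polynomial.continuous _).intervalIntegrable _ _)
    ((Polynomial.continuous _).intervalIntegrable _ _)
  have hm := hc m
  have hn := hc n
  rw [intervalIntegral.integral_add (Continuous.intervalIntegrable (by fun_prop) _ _)
    (Continuous.intervalIntegrable (by fun_prop) _ _)] at h
  simp only [intervalIntegral.integral_same, mul_zero, sub_zero] at h
  rw [← h, legendreCoeff, legendreCoeff]
  simp only [mul_comm]

theorem legendreCoeff_swap {m n : ℕ} (h : m ≠ 0 ∨ n ≠ 0) :
    legendreCoeff m n = -legendreCoeff n m := by
  have hs := legendreCoeff_add_swap m n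
  have h0 : (∫ x in (-1 : ℝ)..1, (legendrePoly m).eval x) *
      ∫ x in (-1 : ℝ)..1, (legendrePoly n).eval x = 0 := by
    rcases h with h | h
    · obtain ⟨k, rfl⟩ := Nat.exists_eq_succ_of_ne_zero h
      rw [integral_legendrePoly_succ, zero_mul]
    · obtain ⟨k, rfl⟩ := Nat.exists_eq_succ_of_ne_zero h
      rw [integral_legendrePoly_succ, mul_zero]
  linarith

theorem legendreCoeff_zero_zero : legendreCoeff 0 0 = 2 := by
  have hs := legendreCoeff_add_swap 0 0
  have h0 : legendrePoly 0 = 1 := by simp [legendrePoly]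
  simp only [h0, Polynomial.eval_one, intervalIntegral.integral_const] at hs
  norm_num at hs
  linarith

theorem legendreCoeff_eq_zero {m n : ℕ} (h : ¬((n = 0 ∧ m = 0) ∨ n + 1 = m ∨ m + 1 = n)) :
    legendreCoeff m n = 0 := by
  rcases lt_trichotomy m n with hlt | rfl | hlt
  · obtain ⟨k, rfl⟩ := Nat.exists_eq_add_of_lt hlt
    rw [legendreCoeff_swap (Or.inr (by omega)), legendreCoeff_eq_zero_of_lt (by omega), neg_zero]
  · have := legendreCoeff_swap (m := m) (n := m) (by omega)
    linarith
  · obtain ⟨k, rfl⟩ := Nat.exists_eq_add_of_lt hlt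
    exact legendreCoeff_eq_zero_of_lt (by omega)

theorem integral_comp_affine {t T : ℝ} (h : t < T) (f : ℝ → ℝ) (s : ℝ) :
    ∫ x in t..s, f ((x - t - (T - t) / 2) * (2 / (T - t))) =
      (T - t) / 2 * ∫ y in (-1 : ℝ)..((s - t - (T - t) / 2) * (2 / (T - t))), f y := by
  have hΔ : T - t ≠ 0 := (sub_pos.mpr h).ne'
  have hfun : (fun x => f ((x - t - (T - t) / 2) * (2 / (T - t)))) =
      fun x => f (2 / (T - t) * x - (t + (T - t) / 2) * (2 / (T - t))) := by
    ext x; congr 1; ring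
  rw [hfun, intervalIntegral.integral_comp_mul_sub f (by positivity), smul_eq_mul, inv_div]
  congr 2
  · field_simp; ring
  · ring

theorem integral_shiftedLegendre_mul {t T : ℝ} (h : t < T) (m n : ℕ) :
    ∫ s in t..T, shiftedLegendre t T m s * ∫ τ in t..s, shiftedLegendre t T n τ =
      (T - t) / 4 * √((2 * m + 1) * (2 * n + 1)) * legendreCoeff m n := by
  have hΔ : 0 < T - t := sub_pos.mpr h
  simp only [shiftedLegendre, legendreP_eq_eval, intervalIntegral.integral_const_mul]
  simp only [integral_comp_affine h fun y => (legendrePoly n).eval y]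
  have hend : (T - t - (T - t) / 2) * (2 / (T - t)) = 1 := by field_simp; ring
  have hI := integral_comp_affine h
    (fun y => √((2 * m + 1) / (T - t)) * (legendrePoly m).eval y * (√((2 * n + 1) / (T - t)) *
      ((T - t) / 2 * ∫ z in (-1 : ℝ)..y, (legendrePoly n).eval z))) T
  rw [hI, hend]
  have hfun : ∀ y : ℝ, √((2 * m + 1) / (T - t)) * (legendrePoly m).eval y *
      (√((2 * n + 1) / (T - t)) * ((T - t) / 2 * ∫ z in (-1 : ℝ)..y, (legendrePoly n).eval z)) =
      √((2 * m + 1) / (T - t)) * √((2 * n + 1) / (T - t)) * ((T - t) / 2) *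
      ((legendrePoly m).eval y * ∫ z in (-1 : ℝ)..y, (legendrePoly n).eval z) := fun y => by ring
  simp only [hfun]
  rw [intervalIntegral.integral_const_mul, Real.sqrt_div (by positivity),
    Real.sqrt_div (by positivity), Real.sqrt_mul (by positivity), legendreCoeff]
  have hsq : √(T - t) ^ 2 = T - t := Real.sq_sqrt hΔ.le
  have hs0 : √(T - t) ≠ 0 := (Real.sqrt_pos.mpr hΔ).ne'
  field_simp
  rw [hsq]
  ring

theorem mul_sqrt_mul_legendreCoeff_succ_self (Δ : ℝ) (n : ℕ) :
    Δ / 4 * √((2 * (n + 1 : ℕ) + 1) * (2 * n + 1)) * legendreCoeff (n + 1) n =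
      Δ / (2 * √(4 * ((n + 1 : ℕ) : ℝ) ^ 2 - 1)) := by
  have hr : 4 * ((n + 1 : ℕ) : ℝ) ^ 2 - 1 = (2 * (n + 1 : ℕ) + 1) * (2 * n + 1) := by
    push_cast; ring
  rw [hr, legendreCoeff_succ_self]
  have hp : (0 : ℝ) < (2 * (n + 1 : ℕ) + 1) * (2 * n + 1) := by positivity
  have hd : ((2 * n + 1) * (2 * n + 3) : ℝ) =
      √((2 * (n + 1 : ℕ) + 1) * (2 * n + 1)) ^ 2 := by
    rw [Real.sq_sqrt hp.le]; push_cast; ring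
  have hs := (Real.sqrt_pos.mpr hp).ne'
  rw [hd]
  field_simp
  ring

/-- The double Fourier–Legendre coefficients
`C_{j₂j₁} = ∫_t^T φ_{j₂}(s) (∫_t^s φ_{j₁}(τ) dτ) ds` of the kernel `1_{t₁<t₂}`:
`C_{00} = Δ/2`; `C_{j₂,j₂−1} = Δ/(2√(4j₂²−1))` for `j₂ ≥ 1`;
`C_{j₁−1,j₁} = −Δ/(2√(4j₁²−1))` for `j₁ ≥ 1`; and `C_{j₂j₁} = 0` otherwise. -/
theorem double_fourierLegendre_coeffs (t T : ℝ) (h : t < T)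
    (C : ℕ → ℕ → ℝ)
    (hC : ∀ j₂ j₁, C j₂ j₁ =
      ∫ s in t..T, shiftedLegendre t T j₂ s * ∫ τ in t..s, shiftedLegendre t T j₁ τ) :
    C 0 0 = (T - t) / 2 ∧
    (∀ j₂ : ℕ, 1 ≤ j₂ →
      C j₂ (j₂ - 1) = (T - t) / (2 * Real.sqrt (4 * (j₂ : ℝ) ^ 2 - 1))) ∧
    (∀ j₁ : ℕ, 1 ≤ j₁ →
      C (j₁ - 1) j₁ = -((T - t) / (2 * Real.sqrt (4 * (j₁ : ℝ) ^ 2 - 1)))) ∧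
    (∀ j₂ j₁ : ℕ, ¬((j₁ = 0 ∧ j₂ = 0) ∨ j₁ + 1 = j₂ ∨ j₂ + 1 = j₁) →
      C j₂ j₁ = 0) := by
  simp only [integral_shiftedLegendre_mul h] at hC
  refine ⟨?_, fun j₂ hj => ?_, fun j₁ hj => ?_, fun j₂ j₁ hj => ?_⟩
  · rw [hC, legendreCoeff_zero_zero]
    norm_num
    ring
  · obtain ⟨n, rfl⟩ := Nat.exists_eq_add_of_le' hj
    rw [hC, Nat.add_sub_cancel, mul_sqrt_mul_legendreCoeff_succ_self]
  · obtain ⟨n, rfl⟩ := Nat.exists_eq_add_of_le' hj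
    rw [hC, Nat.add_sub_cancel, legendreCoeff_swap (Or.inr n.succ_ne_zero),
      ← mul_sqrt_mul_legendreCoeff_succ_self, mul_neg, mul_comm (2 * (n : ℝ) + 1)]
  · rw [hC, legendreCoeff_eq_zero hj, mul_zero]
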